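/- Let g(σ) = √(3/2)‖dev σ‖ + A_θ tr σ − σᵖ on symmetric matrices σ ∈ Sym(n), with A_θ > 0, σᵖ ≥ 0. Define the support-function-type dissipation potential φ(ε̇ᵖ) = sup{ ⟨σ̃, ε̇ᵖ⟩ : g(σ̃) ≤ c } for a constant c ∈ ℝ. Then φ(ε̇ᵖ) = (tr ε̇ᵖ / (3 A_θ))·(c + σᵖ) if tr ε̇ᵖ ≥ √6 · A_θ · ‖dev ε̇ᵖ‖, and φ(ε̇ᵖ) = +∞ otherwise. -/

import Mathlib

open Matrix

/-- Frobenius inner product of `3 × 3` matrices. -/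
def finner (A B : Matrix (Fin 3) (Fin 3) ℝ) : ℝ := ∑ i, ∑ j, A i j * B i j

/-- Frobenius norm of a `3 × 3` matrix. -/
noncomputable def fnorm (A : Matrix (Fin 3) (Fin 3) ℝ) : ℝ := Real.sqrt (∑ i, ∑ j, (A i j) ^ 2)

/-- Deviatoric part of a `3 × 3` matrix. -/
noncomputable def dev (A : Matrix (Fin 3) (Fin 3) ℝ) : Matrix (Fin 3) (Fin 3) ℝ :=
  A - (A.trace / 3) • 1

theorem fnorm_nonneg (A : Matrix (Fin 3) (Fin 3) ℝ) : 0 ≤ fnorm A :=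
  Real.sqrt_nonneg _

theorem fnorm_zero : fnorm 0 = 0 := by
  simp [fnorm]

theorem fnorm_sq (A : Matrix (Fin 3) (Fin 3) ℝ) : fnorm A ^ 2 = finner A A := by
  rw [fnorm, Real.sq_sqrt (by positivity)]
  simp only [finner, sq]

theorem fnorm_smul {a : ℝ} (ha : 0 ≤ a) (A : Matrix (Fin 3) (Fin 3) ℝ) :
    fnorm (a • A) = a * fnorm A := by
  simp only [fnorm, Matrix.smul_apply, smul_eq_mul, mul_pow, ← Finset.mul_sum]
  rw [Real.sqrt_mul (sq_nonneg a), Real.sqrt_sq ha]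

theorem finner_smul_left (a : ℝ) (A B : Matrix (Fin 3) (Fin 3) ℝ) :
    finner (a • A) B = a * finner A B := by
  simp only [finner, Matrix.smul_apply, smul_eq_mul, mul_assoc, Finset.mul_sum]

/-- Cauchy–Schwarz inequality for the Frobenius inner product. -/
theorem finner_le_fnorm_mul_fnorm (A B : Matrix (Fin 3) (Fin 3) ℝ) :
    finner A B ≤ fnorm A * fnorm B := by
  simpa only [finner, fnorm, Fintype.sum_prod_type] using
    Real.sum_mul_le_sqrt_mul_sqrt (Finset.univ : Finset (Fin 3 × Fin 3))
      (fun p => A p.1 p.2) (fun p => B p.1 p.2)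

theorem trace_dev (A : Matrix (Fin 3) (Fin 3) ℝ) : (dev A).trace = 0 := by
  simp [dev, Matrix.trace_sub, Matrix.trace_smul]

theorem isSymm_dev {A : Matrix (Fin 3) (Fin 3) ℝ} (hA : A.IsSymm) : (dev A).IsSymm :=
  hA.sub (Matrix.isSymm_one.smul _)

/-- The Frobenius inner product splits into deviatoric and spherical parts. -/
theorem finner_eq_dev_add_trace (A B : Matrix (Fin 3) (Fin 3) ℝ) :
    finner A B = finner (dev A) (dev B) + A.trace * B.trace / 3 := by
  simp [finner, dev, Matrix.trace, Fin.sum_univ_three, Matrix.one_apply]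
  ring

theorem trace_add_spherical {S : Matrix (Fin 3) (Fin 3) ℝ} (hS : S.trace = 0) (t : ℝ) :
    (S + (t / 3) • (1 : Matrix (Fin 3) (Fin 3) ℝ)).trace = t := by
  simp [Matrix.trace_add, Matrix.trace_smul, hS]

theorem dev_add_spherical {S : Matrix (Fin 3) (Fin 3) ℝ} (hS : S.trace = 0) (t : ℝ) :
    dev (S + (t / 3) • (1 : Matrix (Fin 3) (Fin 3) ℝ)) = S := by
  rw [dev, trace_add_spherical hS, add_sub_cancel_right]

theorem sqrt_three_halves : Real.sqrt (3 / 2) = Real.sqrt 6 / 2 := by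
  rw [Real.sqrt_eq_iff_mul_self_eq (by norm_num) (by positivity)]
  have h : Real.sqrt 6 * Real.sqrt 6 = 6 := Real.mul_self_sqrt (by norm_num)
  linarith

/-- The plastic dissipation potential of the non-associative Drucker–Prager model:
`φ(ε̇ᵖ) = sup{⟨σ̃, ε̇ᵖ⟩ : g(σ̃) ≤ c}` with
`g(σ̃) = √(3/2)‖dev σ̃‖ + A_θ tr σ̃ − σᵖ` equals
`(tr ε̇ᵖ/(3A_θ))(c + σᵖ)` if `tr ε̇ᵖ ≥ √6·A_θ·‖dev ε̇ᵖ‖` (the supremum is then attained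
as a least upper bound) and is `+∞` (the set of values is unbounded above) otherwise. -/
theorem stmt_9 (Aθ σp c : ℝ) (hAθ : 0 < Aθ) (hσp : 0 ≤ σp)
    (g : Matrix (Fin 3) (Fin 3) ℝ → ℝ)
    (hg : g = fun σ => Real.sqrt (3 / 2) * fnorm (dev σ) + Aθ * σ.trace - σp)
    (εp : Matrix (Fin 3) (Fin 3) ℝ) (hεp : εp.IsSymm) :
    (εp.trace ≥ Real.sqrt 6 * Aθ * fnorm (dev εp) →
      IsLUB {r : ℝ | ∃ σ : Matrix (Fin 3) (Fin 3) ℝ, σ.IsSymm ∧ g σ ≤ c ∧ r = finner σ εp}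
        (εp.trace / (3 * Aθ) * (c + σp))) ∧
    (¬ εp.trace ≥ Real.sqrt 6 * Aθ * fnorm (dev εp) →
      ¬ BddAbove {r : ℝ | ∃ σ : Matrix (Fin 3) (Fin 3) ℝ, σ.IsSymm ∧ g σ ≤ c ∧
        r = finner σ εp}) := by
  subst hg
  have hq : Real.sqrt 6 * Real.sqrt 6 = 6 := Real.mul_self_sqrt (by norm_num)
  have hq0 : 0 < Real.sqrt 6 := by positivity
  have he0 := fnorm_nonneg (dev εp)
  have hmem : ∀ (S : Matrix (Fin 3) (Fin 3) ℝ) (t : ℝ), S.IsSymm → S.trace = 0 →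
      Real.sqrt 6 / 2 * fnorm S + Aθ * t ≤ c + σp →
      finner S (dev εp) + t * εp.trace / 3 ∈
        {r : ℝ | ∃ σ : Matrix (Fin 3) (Fin 3) ℝ, σ.IsSymm ∧
          (fun σ => Real.sqrt (3 / 2) * fnorm (dev σ) + Aθ * σ.trace - σp) σ ≤ c ∧
          r = finner σ εp} := by
    intro S t hS htr h
    refine ⟨S + (t / 3) • 1, hS.add (Matrix.isSymm_one.smul _), ?_, ?_⟩
    · simp only [dev_add_spherical htr, trace_add_spherical htr, sqrt_three_halves]
      linarith
    · rw [finner_eq_dev_add_trace (S + _), dev_add_spherical htr, trace_add_spherical htr]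
  constructor
  · intro hcone
    have htr : 0 ≤ εp.trace := le_trans (by positivity) hcone
    constructor
    · rintro r ⟨σ, -, hσ, rfl⟩
      simp only [sqrt_three_halves] at hσ
      rw [finner_eq_dev_add_trace, div_mul_eq_mul_div, le_div_iff₀ (by positivity)]
      have hs0 := fnorm_nonneg (dev σ)
      have hcs := mul_le_mul_of_nonneg_right (finner_le_fnorm_mul_fnorm (dev σ) (dev εp)) hAθ.le
      have hyield := mul_le_mul_of_nonneg_left hσ htr
      have hslope := mul_le_mul_of_nonneg_left hcone (mul_nonneg hq0.le hs0)
      have hsq : Real.sqrt 6 * fnorm (dev σ) * (Real.sqrt 6 * Aθ * fnorm (dev εp)) =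
          6 * (fnorm (dev σ) * fnorm (dev εp) * Aθ) := by
        linear_combination (fnorm (dev σ) * Aθ * fnorm (dev εp)) * hq
      nlinarith
    · intro b hb
      refine le_of_eq_of_le ?_ (hb (hmem 0 ((c + σp) / Aθ) Matrix.isSymm_zero (by simp) ?_))
      · simp only [finner, Matrix.zero_apply, zero_mul, Finset.sum_const_zero]
        field_simp
        ring
      · rw [fnorm_zero, mul_div_cancel₀ _ hAθ.ne']
        simp
  · rintro hcone ⟨b, hb⟩
    rw [ge_iff_le, not_le] at hcone
    -- Along a ray of admissible stresses the work rate grows linearly.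
    have hray : ∀ a d : ℝ, 0 < d → ∃ l : ℝ, 0 ≤ l ∧ b < a + l * d := by
      intro a d hd
      refine ⟨(|b - a| + 1) / d, by positivity, ?_⟩
      rw [div_mul_cancel₀ _ hd.ne']
      linarith [le_abs_self (b - a)]
    rcases lt_or_ge εp.trace 0 with htr | htr
    · obtain ⟨l, hl, hlt⟩ := hray ((c + σp) / Aθ * εp.trace / 3) (-εp.trace / 3) (by linarith)
      have := hb (hmem 0 ((c + σp) / Aθ - l) Matrix.isSymm_zero (by simp) (by
        rw [fnorm_zero, mul_sub, mul_div_cancel₀ _ hAθ.ne']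
        linarith [mul_nonneg hAθ.le hl]))
      simp only [finner, Matrix.zero_apply, zero_mul, Finset.sum_const_zero] at this
      linarith
    · have hepos : 0 < fnorm (dev εp) := by
        refine he0.lt_of_ne fun h => ?_
        rw [← h, mul_zero] at hcone
        linarith
      have hd : 0 < fnorm (dev εp) *
          (fnorm (dev εp) - Real.sqrt 6 * εp.trace / (6 * Aθ)) := by
        refine mul_pos hepos (sub_pos.2 ((div_lt_iff₀ (by positivity)).2 ?_))
        have := mul_lt_mul_of_pos_left hcone hq0
        linear_combination this + Aθ * fnorm (dev εp) * hq
      obtain ⟨l, hl, hlt⟩ := hray ((c + σp) / Aθ * εp.trace / 3) _ hd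
      have := hb (hmem (l • dev εp)
        ((c + σp - Real.sqrt 6 / 2 * (l * fnorm (dev εp))) / Aθ)
        ((isSymm_dev hεp).smul l) (by rw [Matrix.trace_smul, trace_dev, smul_zero]) (by
          rw [fnorm_smul hl, mul_div_cancel₀ _ hAθ.ne']
          linarith))
      rw [finner_smul_left, ← fnorm_sq] at this
      refine absurd (hlt.trans_le (le_of_eq_of_le ?_ this)) (lt_irrefl b)
      field_simp
      ring
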